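/- arXiv:2402.12068 — 2 statements merged into one kernel-verified Lean document; each statement's English description precedes it below -/
import Mathlib

section
/- Every continuous first-price auction with iid priors (a single atomless Borel probability distribution F on [0,1] serving as every bidder's belief about every other bidder) and a finite (discrete) bidding space has a pure Bayes–Nash equilibrium that is symmetric (all bidders use the same strategy) and monotone (each bidder's strategy is a non-decreasing step function from values to bids). -/
open Finset MeasureTheory

/-- Ex-post utility of bidder `i` with value `v` under bid profile `bb`:
`(v - bb i)/|W|` if `i` is among the highest bidders `W` (uniform tie-breaking), else `0`. -/
noncomputable def exPost (n : ℕ) (i : Fin n) (v : ℝ) (bb : Fin n → ℝ) : ℝ :=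
  if ∀ k, bb k ≤ bb i then
    (v - bb i) / ((Finset.univ.filter (fun j : Fin n => ∀ k, bb k ≤ bb j)).card : ℝ)
  else 0

/-- Interim utility of bidder `i` bidding `b` with value `v` in a continuous
first-price auction with iid prior `F`: the expectation of the ex-post utility when
each opponent `j`'s value is drawn independently from `F` and mapped through her pure
strategy `β j`. -/
noncomputable def cInterimIID (n : ℕ) (F : Measure ℝ) (β : Fin n → ℝ → ℝ)
    (i : Fin n) (b : ℝ) (v : ℝ) : ℝ :=
  ∫ vv : Fin n → ℝ,
    exPost n i v (Function.update (fun j => β j (vv j)) i b)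
    ∂(Measure.pi (fun j : Fin n => if j = i then Measure.dirac 0 else F))

/-- The probability of winning under uniform tie-breaking among `n` bidders with a bid that each
opponent underbids with probability `q` and does not exceed with probability `p`. -/
noncomputable def winProb (n : ℕ) (q p : ℝ) : ℝ :=
  (∑ j ∈ range n, p ^ j * q ^ (n - 1 - j)) / n

lemma continuous_winProb (n : ℕ) : Continuous fun x : ℝ × ℝ => winProb n x.1 x.2 := by
  unfold winProb
  fun_prop

lemma winProb_mono {n : ℕ} {q q' p p' : ℝ} (hq : 0 ≤ q) (hp : 0 ≤ p) (hqq : q ≤ q')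
    (hpp : p ≤ p') : winProb n q p ≤ winProb n q' p' := by
  unfold winProb
  gcongr
  exact pow_nonneg (hp.trans hpp) _

lemma winProb_nonneg {n : ℕ} {q p : ℝ} (hq : 0 ≤ q) (hp : 0 ≤ p) : 0 ≤ winProb n q p := by
  unfold winProb
  positivity

lemma winProb_le_one {n : ℕ} {q p : ℝ} (hq : 0 ≤ q) (hp : 0 ≤ p) (hq1 : q ≤ 1) (hp1 : p ≤ 1) :
    winProb n q p ≤ 1 := by
  refine div_le_one_of_le₀ ?_ (Nat.cast_nonneg n)
  calc ∑ j ∈ range n, p ^ j * q ^ (n - 1 - j) ≤ ∑ _j ∈ range n, (1 : ℝ) :=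
        sum_le_sum fun j _ =>
          mul_le_one₀ (pow_le_one₀ hp hp1) (pow_nonneg hq _) (pow_le_one₀ hq hq1)
    _ = n := by simp

lemma winProb_pos {n : ℕ} {q p : ℝ} (hn : 0 < n) (hq : 0 ≤ q) (hp : 0 < p) :
    0 < winProb n q p := by
  unfold winProb
  refine div_pos (sum_pos' (fun j _ => by positivity) ⟨n - 1, by simp; omega, ?_⟩)
    (by exact_mod_cast hn)
  simp only [tsub_self, pow_zero, mul_one]
  positivity

/-- A relation with closed graph into a compact space which is uniquely solvable has a continuous
solution. -/
lemma exists_continuous_of_isClosed_of_existsUnique {X Y : Type*} [TopologicalSpace X]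
    [TopologicalSpace Y] [CompactSpace Y] {R : X → Y → Prop}
    (hR : IsClosed {z : X × Y | R z.1 z.2}) (h : ∀ x, ∃ y, R x y)
    (hu : ∀ x y y', R x y → R x y' → y = y') :
    ∃ f : X → Y, Continuous f ∧ ∀ x, R x (f x) := by
  choose f hf using h
  refine ⟨f, continuous_iff_isClosed.2 fun s hs => ?_, hf⟩
  have : f ⁻¹' s = Prod.fst '' ({z : X × Y | R z.1 z.2} ∩ Prod.snd ⁻¹' s) := by
    ext x
    constructor
    · exact fun hx => ⟨(x, f x), ⟨hf x, hx⟩, rfl⟩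
    · rintro ⟨⟨x, y⟩, ⟨h1, h2⟩, rfl⟩
      have := hu _ _ _ h1 (hf x)
      simpa [← this] using h2
  rw [this]
  exact isClosedMap_fst_of_compactSpace _ (hR.inter (hs.preimage continuous_snd))

/-- The perturbed gain of the type `α` from the bid `b` when this bid is made by the types
between `x` and `α`. -/
noncomputable def bidGain (n : ℕ) (G : ℝ → ℝ) (b δ α x : ℝ) : ℝ :=
  max (α - b) 0 * winProb n (G x) (G α) - δ * (α - x)

section

variable {n : ℕ} {G : ℝ → ℝ}

lemma continuous_bidGain (hG : Continuous G) (b δ : ℝ) :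
    Continuous fun z : ℝ × ℝ => bidGain n G b δ z.1 z.2 := by
  have := (continuous_winProb n).comp
    ((hG.comp continuous_snd).prodMk (hG.comp (continuous_fst (X := ℝ) (Y := ℝ))))
  have h2 : Continuous fun z : ℝ × ℝ => winProb n (G z.2) (G z.1) := this
  unfold bidGain
  fun_prop

lemma bidGain_lt (hG : Monotone G) (hG0 : ∀ x, 0 ≤ G x) {b δ α x y : ℝ} (hδ : 0 < δ)
    (hxy : x < y) : bidGain n G b δ α x < bidGain n G b δ α y := by
  have h1 : winProb n (G x) (G α) ≤ winProb n (G y) (G α) :=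
    winProb_mono (hG0 _) (hG0 _) (hG hxy.le) le_rfl
  have h2 := mul_le_mul_of_nonneg_left h1 (le_max_right (α - b) 0)
  unfold bidGain
  nlinarith

/-- The threshold at which the types below `α`, where the type `α` has utility `u`, start
bidding `b`, as a continuous function of `α` and `u`. -/
lemma exists_threshold (hG : Continuous G) (hGm : Monotone G) (hG0 : ∀ x, 0 ≤ G x) (b : ℝ)
    {δ : ℝ} (hδ : 0 < δ) :
    ∃ A : Set.Icc (0 : ℝ) 1 × ℝ → Set.Icc (0 : ℝ) 1, Continuous A ∧
      ∀ z, (A z : ℝ) ≤ z.1 ∧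
        (bidGain n G b δ z.1 (A z) ≤ z.2 ∨ (A z : ℝ) = 0) ∧
        (z.2 ≤ bidGain n G b δ z.1 (A z) ∨ (A z : ℝ) = z.1) := by
  have hc := continuous_bidGain (n := n) hG b δ
  refine exists_continuous_of_isClosed_of_existsUnique
    (R := fun (z : Set.Icc (0 : ℝ) 1 × ℝ) (x : Set.Icc (0 : ℝ) 1) => (x : ℝ) ≤ z.1 ∧
        (bidGain n G b δ z.1 x ≤ z.2 ∨ (x : ℝ) = 0) ∧
        (z.2 ≤ bidGain n G b δ z.1 x ∨ (x : ℝ) = z.1)) ?_ ?_ ?_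
  · have h2 : Continuous fun w : (Set.Icc (0 : ℝ) 1 × ℝ) × Set.Icc (0 : ℝ) 1 =>
        bidGain n G b δ w.1.1 w.2 :=
      hc.comp (f := fun w : (Set.Icc (0 : ℝ) 1 × ℝ) × Set.Icc (0 : ℝ) 1 =>
        ((w.1.1 : ℝ), (w.2 : ℝ))) (by fun_prop)
    have c1 : Continuous fun w : (Set.Icc (0 : ℝ) 1 × ℝ) × Set.Icc (0 : ℝ) 1 => (w.2 : ℝ) := by
      fun_prop
    have c2 : Continuous fun w : (Set.Icc (0 : ℝ) 1 × ℝ) × Set.Icc (0 : ℝ) 1 => (w.1.1 : ℝ) := by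
      fun_prop
    have c3 : Continuous fun w : (Set.Icc (0 : ℝ) 1 × ℝ) × Set.Icc (0 : ℝ) 1 => w.1.2 := by
      fun_prop
    exact (isClosed_le c1 c2).inter
      (((isClosed_le h2 c3).union (isClosed_eq c1 continuous_const)).inter
      ((isClosed_le c3 h2).union (isClosed_eq c1 c2)))
  · rintro ⟨⟨α, hα⟩, u⟩
    have hcα : Continuous fun x => bidGain n G b δ α x :=
      hc.comp (f := fun x : ℝ => (α, x)) (by fun_prop)
    by_cases h0 : u ≤ bidGain n G b δ α 0
    · exact ⟨⟨0, by simp⟩, hα.1, Or.inr rfl, Or.inl h0⟩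
    by_cases h1 : bidGain n G b δ α α ≤ u
    · exact ⟨⟨α, hα⟩, le_rfl, Or.inl h1, Or.inr rfl⟩
    push Not at h0 h1
    obtain ⟨x, hx, hxu⟩ := intermediate_value_Icc hα.1 hcα.continuousOn ⟨h0.le, h1.le⟩
    exact ⟨⟨x, hx.1, hx.2.trans hα.2⟩, hx.2, Or.inl hxu.le, Or.inl hxu.ge⟩
  · have key : ∀ (z : Set.Icc (0 : ℝ) 1 × ℝ) (x y : Set.Icc (0 : ℝ) 1),
        (y : ℝ) ≤ z.1 → (z.2 ≤ bidGain n G b δ z.1 x ∨ (x : ℝ) = z.1) →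
        (bidGain n G b δ z.1 y ≤ z.2 ∨ (y : ℝ) = 0) → ¬ (x : ℝ) < y := by
      intro z x y hy hx1 hy1 hxy
      have h1 := hx1.resolve_right (by linarith)
      have h2 := hy1.resolve_right (by linarith [x.2.1])
      linarith [bidGain_lt (n := n) hGm hG0 hδ hxy (b := b) (α := z.1)]
    rintro z x y ⟨hx, hx1, hx2⟩ ⟨hy, hy1, hy2⟩
    exact Subtype.ext (le_antisymm (not_lt.1 (key z y x hx hy2 hx1))
      (not_lt.1 (key z x y hy hx2 hy1)))

/-- The winning probability of the bid made by the types between the `k`-th and the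
`k+1`-st thresholds. -/
noncomputable def segProb (n : ℕ) (G : ℝ → ℝ) (a : ℕ → ℝ) (k : ℕ) : ℝ :=
  winProb n (G (a k)) (G (a (k + 1)))

/-- The utility of the type at the `k`-th threshold. -/
noncomputable def thrUtil (n : ℕ) (G : ℝ → ℝ) (a : ℕ → ℝ) (k : ℕ) : ℝ :=
  ∑ i ∈ range k, (a (i + 1) - a i) * segProb n G a i

/-- The thresholds `a` support the first `m + 1` bids in an equilibrium, up to an error `δ`, when
the types are bounded by `a (m + 1)`. -/
def IsSupported (n : ℕ) (G : ℝ → ℝ) (b : ℕ → ℝ) (δ : ℝ) (m : ℕ) (a : ℕ → ℝ) : Prop :=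
  a 0 = 0 ∧ (∀ k, a k ∈ Set.Icc (0 : ℝ) 1) ∧ ∀ k ≤ m, a k ≤ a (k + 1) ∧
    max (a (k + 1) - b k) 0 * segProb n G a k ≤ thrUtil n G a (k + 1) + δ ∧
    (thrUtil n G a (k + 1) ≤ max (a (k + 1) - b k) 0 * segProb n G a k ∨ a k = a (k + 1))

lemma exists_shooting (hG : Continuous G) (hGm : Monotone G) (hG0 : ∀ x, 0 ≤ G x)
    (hG1 : ∀ x, G x ≤ 1) {b : ℕ → ℝ} (hb : Monotone b) (hb0 : b 0 = 0)
    {δ : ℝ} (hδ : 0 < δ) (m : ℕ) :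
    ∃ Φ : Set.Icc (0 : ℝ) 1 × ℝ → ℝ, Continuous Φ ∧ (∀ z, z.2 < 0 → Φ z < 0) ∧
      (∀ z, (z.1 : ℝ) ≤ z.2 → 0 ≤ Φ z) ∧
      ∀ z, Φ z = 0 → ∃ a, IsSupported n G b δ m a ∧ a (m + 1) = z.1 ∧
        thrUtil n G a (m + 1) = z.2 := by
  have hH0 : ∀ x y, 0 ≤ winProb n (G x) (G y) := fun x y => winProb_nonneg (hG0 x) (hG0 y)
  have hH1 : ∀ x y, winProb n (G x) (G y) ≤ 1 :=
    fun x y => winProb_le_one (hG0 x) (hG0 y) (hG1 x) (hG1 y)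
  have hHc : Continuous fun z : ℝ × ℝ => winProb n (G z.1) (G z.2) :=
    (continuous_winProb n).comp (f := fun z : ℝ × ℝ => (G z.1, G z.2)) (by fun_prop)
  induction m with
  | zero =>
    refine ⟨fun z => z.2 - z.1 * winProb n (G 0) (G z.1), ?_, ?_, ?_, ?_⟩
    · have : Continuous fun z : Set.Icc (0 : ℝ) 1 × ℝ => winProb n (G 0) (G z.1) :=
        hHc.comp (f := fun z : Set.Icc (0 : ℝ) 1 × ℝ => ((0 : ℝ), (z.1 : ℝ))) (by fun_prop)
      fun_prop
    · intro z hz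
      have := mul_nonneg z.1.2.1 (hH0 0 z.1)
      dsimp only
      linarith
    · intro z hz
      have := mul_le_mul_of_nonneg_left (hH1 0 z.1) z.1.2.1
      dsimp only
      linarith
    · rintro ⟨⟨α, hα⟩, u⟩ hz
      simp only at hz
      have hu : thrUtil n G (fun k => if k = 0 then 0 else α) (0 + 1) = u := by
        simp [thrUtil, segProb]
        linarith
      refine ⟨fun k => if k = 0 then 0 else α, ⟨by simp, ?_, ?_⟩, by simp, hu⟩
      · intro k
        dsimp only
        split_ifs
        · simp
        · exact hα
      · intro k hk
        obtain rfl : k = 0 := by omega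
        rw [hu]
        simp [segProb, hb0, hα.1]
        constructor
        · linarith
        · left; linarith
  | succ m ih =>
    obtain ⟨Φ, hΦc, hΦn, hΦp, hΦ⟩ := ih
    obtain ⟨A, hAc, hA⟩ := exists_threshold (n := n) hG hGm hG0 (b (m + 1)) hδ
    have hb1 : 0 ≤ b (m + 1) := hb0 ▸ hb (Nat.zero_le _)
    refine ⟨fun z => Φ (A z, z.2 - (z.1 - A z) * winProb n (G (A z)) (G z.1)), ?_, ?_, ?_, ?_⟩
    · have : Continuous fun z : Set.Icc (0 : ℝ) 1 × ℝ => winProb n (G (A z)) (G z.1) :=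
        hHc.comp (f := fun z : Set.Icc (0 : ℝ) 1 × ℝ => ((A z : ℝ), (z.1 : ℝ))) (by fun_prop)
      fun_prop
    · intro z hz
      apply hΦn
      have := mul_nonneg (sub_nonneg.2 (hA z).1) (hH0 (A z) z.1)
      dsimp only
      linarith
    · intro z hz
      have hAz : (A z : ℝ) = z.1 := by
        refine (hA z).2.2.elim (fun h => ?_) id
        by_contra hne
        have hlt := lt_of_le_of_ne (hA z).1 hne
        have h1 : max ((z.1 : ℝ) - b (m + 1)) 0 ≤ z.1 := max_le (by linarith) z.1.2.1
        have h2 := mul_le_mul h1 (hH1 (A z) z.1) (hH0 _ _) z.1.2.1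
        have h3 := mul_pos hδ (sub_pos.2 hlt)
        unfold bidGain at h
        linarith
      apply hΦp
      simp only [hAz]
      linarith
    · intro z hz
      have hAz := hA z
      obtain ⟨a, ⟨ha0, ha1, ha⟩, haA, hau⟩ := hΦ _ hz
      simp only at haA hau
      set H := winProb n (G (A z)) (G z.1) with hH
      have hHz := hH0 (A z) z.1
      have hpos : max ((z.1 : ℝ) - b (m + 1)) 0 * H ≤ z.1 * H :=
        mul_le_mul_of_nonneg_right (max_le (by linarith) z.1.2.1) hHz
      have hgain : bidGain n G (b (m + 1)) δ z.1 (A z) ≤ z.2 := by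
        refine hAz.2.1.elim id fun h0 => ?_
        by_contra hlt
        push Not at hlt
        refine (hΦn _ ?_).ne hz
        have h3 := mul_nonneg hδ.le z.1.2.1
        unfold bidGain at hlt
        rw [← hH] at hlt
        change z.2 - (z.1 - A z) * H < 0
        rw [h0] at hlt ⊢
        linarith
      let a' : ℕ → ℝ := fun k => if k ≤ m + 1 then a k else z.1
      have haa : ∀ k ≤ m + 1, a' k = a k := fun k hk => if_pos hk
      have hlast : a' (m + 2) = z.1 := if_neg (by omega)
      have hseg : ∀ k ≤ m, segProb n G a' k = segProb n G a k := by
        intro k hk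
        simp only [segProb, haa k (by omega), haa (k + 1) (by omega)]
      have hutil : ∀ k ≤ m + 1, thrUtil n G a' k = thrUtil n G a k := by
        intro k hk
        refine sum_congr rfl fun i hi => ?_
        have := mem_range.1 hi
        rw [hseg i (by omega), haa i (by omega), haa (i + 1) (by omega)]
      have hsegl : segProb n G a' (m + 1) = H := by
        rw [segProb, haa (m + 1) le_rfl, hlast, haA]
      have hutill : thrUtil n G a' (m + 1 + 1) = z.2 := by
        rw [thrUtil, sum_range_succ]
        change thrUtil n G a' (m + 1) + _ = _
        rw [hutil _ le_rfl, hau, hsegl, hlast, haa _ le_rfl, haA]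
        ring
      refine ⟨a', ⟨by rw [haa 0 (by omega), ha0], fun k => ?_, fun k hk => ?_⟩, hlast, hutill⟩
      · by_cases hk : k ≤ m + 1
        · rw [haa k hk]; exact ha1 k
        · simp only [a', if_neg hk]; exact z.1.2
      · rcases Nat.lt_or_ge m k with hk' | hk'
        · obtain rfl : k = m + 1 := by omega
          rw [hutill, hsegl, hlast, haa _ le_rfl, haA]
          unfold bidGain at hgain hAz
          rw [← hH] at hgain hAz
          have h3 := mul_nonneg hδ.le (sub_nonneg.2 hAz.1)
          have h4 : δ * (z.1 - A z) ≤ δ * 1 :=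
            mul_le_mul_of_nonneg_left (by linarith [z.1.2.2, (A z).2.1]) hδ.le
          exact ⟨hAz.1, by linarith, hAz.2.2.imp (fun h => by linarith) id⟩
        · rw [haa k (by omega), haa (k + 1) (by omega), hseg k hk', hutil (k + 1) (by omega)]
          exact ha k hk'

lemma exists_isSupported_of_pos (hG : Continuous G) (hGm : Monotone G) (hG0 : ∀ x, 0 ≤ G x)
    (hG1 : ∀ x, G x ≤ 1) {b : ℕ → ℝ} (hb : Monotone b) (hb0 : b 0 = 0)
    {δ : ℝ} (hδ : 0 < δ) (m : ℕ) :
    ∃ a, IsSupported n G b δ m a ∧ a (m + 1) = 1 := by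
  obtain ⟨Φ, hΦc, hΦn, hΦp, hΦ⟩ := exists_shooting (n := n) hG hGm hG0 hG1 hb hb0 hδ m
  let e : Set.Icc (0 : ℝ) 1 := ⟨1, by simp⟩
  have hc : Continuous fun u : ℝ => Φ (e, u) := hΦc.comp (by fun_prop)
  obtain ⟨u, -, hu⟩ := intermediate_value_Icc (a := (-1 : ℝ)) (b := 1) (by norm_num)
    hc.continuousOn ⟨(hΦn (e, -1) (by norm_num)).le, hΦp (e, 1) le_rfl⟩
  obtain ⟨a, ha, ha1, -⟩ := hΦ _ hu
  exact ⟨a, ha, ha1⟩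

lemma continuous_segProb (hG : Continuous G) (k : ℕ) :
    Continuous fun a : ℕ → ℝ => segProb n G a k :=
  (continuous_winProb n).comp (f := fun a : ℕ → ℝ => (G (a k), G (a (k + 1)))) (by fun_prop)

lemma continuous_thrUtil (hG : Continuous G) (k : ℕ) :
    Continuous fun a : ℕ → ℝ => thrUtil n G a k := by
  have := continuous_segProb (n := n) hG
  unfold thrUtil
  fun_prop

lemma isClosed_isSupported (hG : Continuous G) (b : ℕ → ℝ) (δ : ℝ) (m : ℕ) :
    IsClosed {a | IsSupported n G b δ m a} := by
  have h1 := continuous_segProb (n := n) hG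
  have h2 := continuous_thrUtil (n := n) hG
  simp only [IsSupported, Set.ofPred_and, Set.ofPred_forall, Set.ofPred_or]
  refine (isClosed_eq (by fun_prop) (by fun_prop)).inter ((isClosed_iInter fun k =>
    isClosed_Icc.preimage (continuous_apply k)).inter (isClosed_iInter fun k =>
    isClosed_iInter fun _ => (isClosed_le (by fun_prop) (by fun_prop)).inter
    ((isClosed_le (by fun_prop) (by fun_prop)).inter
    ((isClosed_le (by fun_prop) (by fun_prop)).union
    (isClosed_eq (by fun_prop) (by fun_prop))))))

lemma exists_isSupported (hG : Continuous G) (hGm : Monotone G) (hG0 : ∀ x, 0 ≤ G x)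
    (hG1 : ∀ x, G x ≤ 1) {b : ℕ → ℝ} (hb : Monotone b) (hb0 : b 0 = 0) (m : ℕ) :
    ∃ a, IsSupported n G b 0 m a ∧ a (m + 1) = 1 := by
  let t : ℕ → Set (ℕ → ℝ) := fun N =>
    {a | IsSupported n G b (1 / ((N : ℝ) + 1)) m a} ∩ {a | a (m + 1) = 1}
  have hcl : ∀ N, IsClosed (t N) := fun N =>
    (isClosed_isSupported hG b _ m).inter (isClosed_eq (by fun_prop) (by fun_prop))
  obtain ⟨a, ha⟩ := IsCompact.nonempty_iInter_of_sequence_nonempty_isCompact_isClosed t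
    (fun N a ha => ⟨⟨ha.1.1, ha.1.2.1, fun k hk => ⟨(ha.1.2.2 k hk).1,
      (ha.1.2.2 k hk).2.1.trans (add_le_add_right (one_div_le_one_div_of_le (by positivity)
        (by push_cast; linarith)) _), (ha.1.2.2 k hk).2.2⟩⟩, ha.2⟩)
    (fun N => exists_isSupported_of_pos hG hGm hG0 hG1 hb hb0 (by positivity) m)
    ((isCompact_univ_pi fun _ : ℕ => isCompact_Icc (a := (0 : ℝ)) (b := 1)).of_isClosed_subset
      (hcl 0) fun a ha k _ => ha.1.2.1 k) hcl
  rw [Set.mem_iInter] at ha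
  obtain ⟨⟨h0, h1, h2⟩, h3⟩ := ha 0
  refine ⟨a, ⟨h0, h1, fun k hk => ⟨(h2 k hk).1, ?_, (h2 k hk).2.2⟩⟩, h3⟩
  refine ge_of_tendsto' (tendsto_const_nhds.add tendsto_one_div_add_atTop_nhds_zero_nat)
    fun N => ((ha N).1.2.2 k hk).2.1

end

lemma sum_choose_div_eq_winProb (N : ℕ) (q d : ℝ) :
    ∑ t ∈ range (N + 1), N.choose t • (1 / ((t : ℝ) + 1) * (d ^ t * q ^ (N - t))) =
      winProb (N + 1) q (d + q) := by
  have hN : ((N + 1 : ℕ) : ℝ) ≠ 0 := by positivity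
  rw [winProb, eq_div_iff hN]
  by_cases hd : d = 0
  · subst hd
    rw [sum_eq_single 0 (fun t _ ht => by simp [ht]) (by simp)]
    have : ∀ j ∈ range (N + 1), (0 + q) ^ j * q ^ (N + 1 - 1 - j) = q ^ N := by
      intro j hj
      rw [zero_add, ← pow_add]
      congr 1
      have := mem_range.1 hj
      omega
    rw [sum_congr rfl this]
    simp [mul_comm]
  · have h1 := geom_sum₂_mul_add d q (N + 1)
    rw [add_pow, sum_range_succ' _ (N + 1)] at h1
    have h2 : ∀ t ∈ range (N + 1), d ^ (t + 1) * q ^ (N + 1 - (t + 1)) *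
        ((N + 1).choose (t + 1) : ℝ) =
        N.choose t • (1 / ((t : ℝ) + 1) * (d ^ t * q ^ (N - t))) * ((N + 1 : ℕ) : ℝ) * d := by
      intro t _
      have h3 : ((N + 1 : ℕ) : ℝ) * (N.choose t : ℝ) =
          ((N + 1).choose (t + 1) : ℝ) * ((t : ℝ) + 1) := by
        exact_mod_cast Nat.add_one_mul_choose_eq N t
      have h4 : (t : ℝ) + 1 ≠ 0 := by positivity
      rw [nsmul_eq_mul, Nat.add_sub_add_right]
      field_simp
      linear_combination -(d * d ^ t * q ^ (N - t)) * h3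
    rw [sum_congr rfl h2, ← sum_mul, ← sum_mul] at h1
    refine mul_right_cancel₀ hd ?_
    simp only [pow_zero, Nat.sub_zero, Nat.choose_zero_right, Nat.cast_one, one_mul, mul_one] at h1
    linarith

lemma exPost_update_eq_sum {n : ℕ} (i : Fin n) (v b : ℝ) (c : Fin n → ℝ) :
    exPost n i v (Function.update c i b) =
      ∑ T ∈ (univ.erase i).powerset, (v - b) * (1 / ((T.card : ℝ) + 1) *
        ∏ j, if j = i then 1 else if j ∈ T then Set.indicator {b} 1 (c j)
          else Set.indicator (Set.Iio b) 1 (c j)) := by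
  classical
  set bb := Function.update c i b with hbb
  have hi : bb i = b := by simp [hbb]
  have hne : ∀ j, j ≠ i → bb j = c j := fun j hj => by simp [hbb, hj]
  let T₀ := (univ.erase i).filter fun j => c j = b
  have hT₀ : ∀ j, j ∈ T₀ ↔ j ≠ i ∧ c j = b := fun j => by simp [T₀]
  have hprod : ∀ T ∈ (univ.erase i).powerset,
      (∏ j, if j = i then (1 : ℝ) else if j ∈ T then Set.indicator {b} 1 (c j)
          else Set.indicator (Set.Iio b) 1 (c j)) =
        if T = T₀ ∧ ∀ k, bb k ≤ b then 1 else 0 := by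
    intro T hT
    have hiT : i ∉ T := fun h => by simpa using mem_powerset.1 hT h
    split_ifs with h
    · obtain ⟨rfl, hle⟩ := h
      refine prod_eq_one fun j _ => ?_
      split_ifs with h1 h2
      · rfl
      · simp [((hT₀ j).1 h2).2]
      · have h3 := hle j
        rw [hne j h1] at h3
        have h4 : c j ≠ b := fun h => h2 ((hT₀ j).2 ⟨h1, h⟩)
        simp [lt_of_le_of_ne h3 h4]
    · by_contra hne0
      replace hne0 := prod_ne_zero_iff.1 hne0
      refine h ⟨?_, fun k => ?_⟩
      · ext j
        rw [hT₀]
        have := hne0 j (mem_univ j)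
        constructor
        · intro hj
          have hji : j ≠ i := fun h => hiT (h ▸ hj)
          refine ⟨hji, ?_⟩
          by_contra hc
          simp [hji, hj, hc] at this
        · rintro ⟨hji, hc⟩
          by_contra hj
          simp [hji, hj, hc] at this
      · by_cases hk : k = i
        · rw [hk, hi]
        · rw [hne k hk]
          have := hne0 k (mem_univ k)
          by_contra hc
          push Not at hc
          by_cases hkT : k ∈ T <;> simp [hk, hkT, hc.ne', hc.le] at this
  rw [sum_congr rfl fun T hT => by rw [hprod T hT]]
  unfold exPost
  rw [hi]
  by_cases hle : ∀ k, bb k ≤ b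
  · rw [if_pos hle, sum_eq_single T₀]
    · have hcard : (univ.filter fun j : Fin n => ∀ k, bb k ≤ bb j) = insert i T₀ := by
        ext j
        simp only [mem_filter, mem_univ, true_and, mem_insert, hT₀]
        constructor
        · intro h
          by_cases hj : j = i
          · exact Or.inl hj
          · refine Or.inr ⟨hj, ?_⟩
            have h1 := h i
            have h2 := hle j
            rw [hi] at h1
            rw [hne j hj] at h1 h2
            exact le_antisymm h2 h1
        · rintro (rfl | ⟨hj, hc⟩)
          · rwa [hi]
          · rwa [hne j hj, hc]
      rw [hcard, card_insert_of_notMem (by simp [T₀])]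
      simp [hle, div_eq_mul_inv]
    · intro T _ hT
      simp [hT]
    · intro h
      exact absurd (mem_powerset.2 (filter_subset _ _)) h
  · rw [if_neg hle]
    simp [hle]

/-- The interim utility when all opponents use the same strategy. -/
lemma cInterimIID_eq {n : ℕ} (F : Measure ℝ) [IsProbabilityMeasure F] {β : ℝ → ℝ}
    (hβ : Measurable β) (i : Fin n) (b v : ℝ) :
    cInterimIID n F (fun _ => β) i b v =
      (v - b) * winProb n (F.real {x | β x < b}) (F.real {x | β x ≤ b}) := by
  classical
  have hprob : ∀ j : Fin n, IsProbabilityMeasure (if j = i then Measure.dirac (0 : ℝ) else F) := by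
    intro j
    split_ifs <;> infer_instance
  let f : Finset (Fin n) → Fin n → ℝ → ℝ := fun T j x =>
    if j = i then 1 else if j ∈ T then Set.indicator {b} 1 (β x)
      else Set.indicator (Set.Iio b) 1 (β x)
  have hm1 : MeasurableSet {x | β x = b} := hβ (measurableSet_singleton b)
  have hm2 : MeasurableSet {x | β x < b} := hβ measurableSet_Iio
  have e1 : ∀ x, Set.indicator {b} (1 : ℝ → ℝ) (β x) = Set.indicator {x | β x = b} 1 x :=
    fun x => rfl
  have e2 : ∀ x, Set.indicator (Set.Iio b) (1 : ℝ → ℝ) (β x) = Set.indicator {x | β x < b} 1 x :=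
    fun x => rfl
  have hfm : ∀ T j, Measurable (f T j) := by
    intro T j
    simp only [f, e1, e2]
    split_ifs
    · fun_prop
    · exact measurable_one.indicator hm1
    · exact measurable_one.indicator hm2
  have hfb : ∀ T j x, ‖f T j x‖ ≤ 1 := by
    intro T j x
    simp only [f, e1, e2]
    split_ifs
    · simp
    · exact (norm_indicator_le_norm_self _ _).trans (by simp)
    · exact (norm_indicator_le_norm_self _ _).trans (by simp)
  have hint : ∀ T, ∫ vv : Fin n → ℝ, ∏ j, f T j (vv j)
      ∂(Measure.pi (fun j : Fin n => if j = i then Measure.dirac 0 else F)) =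
      ∏ j, if j = i then 1 else if j ∈ T then F.real {x | β x = b} else F.real {x | β x < b} := by
    intro T
    rw [integral_fintype_prod_eq_prod]
    refine prod_congr rfl fun j _ => ?_
    simp only [f, e1, e2]
    split_ifs with h1 h2
    · simp
    · exact integral_indicator_one hm1
    · exact integral_indicator_one hm2
  have hsum : F.real {x | β x = b} + F.real {x | β x < b} = F.real {x | β x ≤ b} := by
    rw [← measureReal_union (by
      rw [Set.disjoint_left]; intro x hx hx'; exact (ne_of_lt hx') hx) hm2]
    congr 1
    ext x
    simp only [Set.mem_union, Set.mem_ofPred_eq]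
    rw [le_iff_eq_or_lt]
  unfold cInterimIID
  simp_rw [exPost_update_eq_sum]
  rw [integral_finsetSum]
  · have hT : ∀ T ∈ (univ.erase i).powerset,
        ∫ vv : Fin n → ℝ, (v - b) * (1 / ((T.card : ℝ) + 1) * ∏ j, f T j (vv j))
        ∂(Measure.pi (fun j : Fin n => if j = i then Measure.dirac 0 else F)) =
        (v - b) * (1 / ((T.card : ℝ) + 1) * (F.real {x | β x = b} ^ T.card *
          F.real {x | β x < b} ^ ((univ.erase i).card - T.card))) := by
      intro T hT
      have hT' := mem_powerset.1 hT
      rw [integral_const_mul, integral_const_mul, hint]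
      congr 2
      rw [← mul_prod_erase _ _ (mem_univ i), if_pos rfl, one_mul,
        ← card_sdiff_of_subset hT', ← prod_sdiff hT', mul_comm]
      congr 1
      · refine prod_eq_pow_card fun j hj => ?_
        rw [if_neg (ne_of_mem_erase (hT' hj)), if_pos hj]
      · refine prod_eq_pow_card fun j hj => ?_
        rw [mem_sdiff] at hj
        rw [if_neg (ne_of_mem_erase hj.1), if_neg hj.2]
    refine (sum_congr rfl hT).trans ?_
    rw [← mul_sum, sum_powerset_apply_card (fun t : ℕ => 1 / ((t : ℝ) + 1) *
      (F.real {x | β x = b} ^ t * F.real {x | β x < b} ^ ((univ.erase i).card - t))),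
      sum_choose_div_eq_winProb, hsum]
    have hn : (univ.erase i).card + 1 = n := by
      rw [card_erase_add_one (mem_univ i)]; simp
    rw [hn]
  · intro T _
    refine Integrable.const_mul (Integrable.const_mul ?_ _) _
    change Integrable (fun vv : Fin n → ℝ => ∏ j, f T j (vv j)) _
    refine Integrable.of_bound (C := 1) (Measurable.aestronglyMeasurable ?_) ?_
    · exact Finset.measurable_fun_prod _ fun j _ => (hfm T j).comp (measurable_pi_apply j)
    · refine Filter.Eventually.of_forall fun vv => ?_
      rw [norm_prod]
      exact prod_le_one (fun j _ => norm_nonneg _) fun j _ => hfb T j _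

lemma le_of_forall_le_succ {f : ℕ → ℝ} {M : ℕ} (h : ∀ k < M, f k ≤ f (k + 1)) {j k : ℕ}
    (hkj : k ≤ j) (hj : j ≤ M) : f k ≤ f j := by
  induction j, hkj using Nat.le_induction with
  | base => exact le_rfl
  | succ j _ ih => exact (ih (by omega)).trans (h j (by omega))

section

variable {n m : ℕ} {G : ℝ → ℝ} {b a : ℕ → ℝ}

lemma IsSupported.threshold_le {δ : ℝ} (ha : IsSupported n G b δ m a) {j k : ℕ} (hkj : k ≤ j)
    (hj : j ≤ m + 1) : a k ≤ a j :=
  le_of_forall_le_succ (fun k hk => (ha.2.2 k (by omega)).1) hkj hj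

lemma IsSupported.segProb_le {δ : ℝ} (hGm : Monotone G) (hG0 : ∀ x, 0 ≤ G x)
    (ha : IsSupported n G b δ m a) {j k : ℕ} (hkj : k ≤ j) (hj : j ≤ m) :
    segProb n G a k ≤ segProb n G a j :=
  winProb_mono (hG0 _) (hG0 _) (hGm (ha.threshold_le hkj (by omega)))
    (hGm (ha.threshold_le (by omega) (by omega)))

lemma thrUtil_succ (n : ℕ) (G : ℝ → ℝ) (a : ℕ → ℝ) (k : ℕ) :
    thrUtil n G a (k + 1) = thrUtil n G a k + (a (k + 1) - a k) * segProb n G a k :=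
  sum_range_succ _ _

lemma segProb_nonneg (hG0 : ∀ x, 0 ≤ G x) (k : ℕ) : 0 ≤ segProb n G a k :=
  winProb_nonneg (hG0 _) (hG0 _)

lemma IsSupported.thrUtil_nonneg {δ : ℝ} (hG0 : ∀ x, 0 ≤ G x)
    (ha : IsSupported n G b δ m a) {k : ℕ} (hk : k ≤ m + 1) : 0 ≤ thrUtil n G a k := by
  refine sum_nonneg fun i hi => ?_
  have := mem_range.1 hi
  exact mul_nonneg (sub_nonneg.2 (ha.threshold_le (by omega) (by omega))) (segProb_nonneg hG0 _)

/-- No bid gives a type at a threshold more than its utility. -/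
lemma IsSupported.bid_le_thrUtil (hGm : Monotone G) (hG0 : ∀ x, 0 ≤ G x)
    (ha : IsSupported n G b 0 m a) {j k : ℕ} (hj : j ≤ m) (hk : k ≤ m + 1) :
    (a k - b j) * segProb n G a j ≤ thrUtil n G a k := by
  have hbase : (a (j + 1) - b j) * segProb n G a j ≤ thrUtil n G a (j + 1) := by
    have h1 := (ha.2.2 j hj).2.1
    have h2 := mul_le_mul_of_nonneg_right (le_max_left (a (j + 1) - b j) 0)
      (segProb_nonneg (n := n) (a := a) hG0 j)
    linarith
  rcases le_total k (j + 1) with h | h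
  · induction h using Nat.decreasingInduction with
    | self => exact hbase
    | of_succ k hk' ih =>
      have h1 := ih (by omega)
      rw [thrUtil_succ] at h1
      have h2 := mul_le_mul_of_nonneg_left (ha.segProb_le hGm hG0 (k := k) (j := j) (by omega) hj)
        (sub_nonneg.2 (ha.2.2 k (by omega)).1)
      linarith
  · induction k, h using Nat.le_induction with
    | base => exact hbase
    | succ k hk' ih =>
      have h1 := ih (by omega)
      rw [thrUtil_succ]
      have h2 := mul_le_mul_of_nonneg_left (ha.segProb_le hGm hG0 (k := j) (j := k) (by omega)
        (by omega)) (sub_nonneg.2 (ha.2.2 k (by omega)).1)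
      linarith

/-- The utility at the upper end of a segment is the gain from the bid made there, which
moreover does not exceed the values in the segment. -/
lemma IsSupported.thrUtil_eq (hG0 : ∀ x, 0 ≤ G x) (hb0 : b 0 = 0)
    (ha : IsSupported n G b 0 m a) {k : ℕ} (hk : k ≤ m)
    (hused : k = 0 ∨ a k < a (k + 1)) (hH : segProb n G a k ≠ 0) :
    thrUtil n G a (k + 1) = (a (k + 1) - b k) * segProb n G a k ∧ b k ≤ a k := by
  have hpos : 0 < segProb n G a k := lt_of_le_of_ne (segProb_nonneg hG0 k) hH.symm
  rcases hused with rfl | hlt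
  · rw [thrUtil_succ]
    simp [thrUtil, ha.1, hb0]
  · obtain ⟨-, h1, h2⟩ := ha.2.2 k hk
    replace h2 := h2.resolve_right hlt.ne
    have h3 := thrUtil_succ n G a k
    have h4 := ha.thrUtil_nonneg hG0 (k := k) (by omega)
    have h5 := mul_pos (sub_pos.2 hlt) hpos
    have h6 : 0 < a (k + 1) - b k := by
      by_contra hle
      rw [max_eq_right (not_lt.1 hle)] at h2
      linarith
    rw [max_eq_left h6.le] at h1 h2
    refine ⟨by linarith, ?_⟩
    by_contra hab
    have := mul_pos (sub_pos.2 (not_le.1 hab)) hpos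
    linarith

/-- The bid assigned to a segment is a best response of all the values in it. -/
lemma IsSupported.bid_le_bid (hGm : Monotone G) (hG0 : ∀ x, 0 ≤ G x) (hb0 : b 0 = 0)
    (ha : IsSupported n G b 0 m a) {j k : ℕ} (hj : j ≤ m) (hk : k ≤ m)
    (hused : k = 0 ∨ a k < a (k + 1)) {v : ℝ} (hv : v ∈ Set.Icc (a k) (a (k + 1))) :
    (v - b j) * segProb n G a j ≤ (v - b k) * segProb n G a k := by
  by_cases hH : segProb n G a k = 0
  · have h1 : thrUtil n G a (k + 1) ≤ 0 := by
      rcases hused with rfl | hlt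
      · rw [thrUtil_succ, hH]
        simp [thrUtil]
      · simpa [hH] using (ha.2.2 k hk).2.2.resolve_right hlt.ne
    have h2 := ha.bid_le_thrUtil hGm hG0 hj (k := k + 1) (by omega)
    have h3 := mul_le_mul_of_nonneg_right (sub_le_sub_right hv.2 (b j))
      (segProb_nonneg (n := n) (a := a) hG0 j)
    rw [hH]
    linarith
  · have h1 := (ha.thrUtil_eq hG0 hb0 hk hused hH).1
    rcases le_total k j with h | h
    · have h2 := ha.bid_le_thrUtil hGm hG0 hj (k := k + 1) (by omega)
      have h3 := mul_le_mul_of_nonneg_left (ha.segProb_le hGm hG0 h hj) (sub_nonneg.2 hv.2)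
      linarith
    · have h2 := ha.bid_le_thrUtil hGm hG0 hj (k := k) (by omega)
      have h3 := mul_le_mul_of_nonneg_left (ha.segProb_le hGm hG0 h hk) (sub_nonneg.2 hv.1)
      rw [thrUtil_succ] at h1
      linarith

end

/-- The index of the segment between successive thresholds which contains `v`. -/
noncomputable def segIndex (a : ℕ → ℝ) (m : ℕ) (v : ℝ) : ℕ :=
  ((range m).filter fun j => a (j + 1) < v).card

lemma segIndex_le (a : ℕ → ℝ) (m : ℕ) (v : ℝ) : segIndex a m v ≤ m :=
  (card_filter_le _ _).trans (card_range m).le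

lemma segIndex_mono (a : ℕ → ℝ) (m : ℕ) : Monotone (segIndex a m) := fun _ _ h =>
  card_le_card (monotone_filter_right _ fun _ _ h' => lt_of_lt_of_le h' h)

lemma segIndex_le_iff {a : ℕ → ℝ} {m k : ℕ} {v : ℝ} (ha : ∀ i j, i ≤ j → j ≤ m + 1 → a i ≤ a j)
    (hk : k < m) : segIndex a m v ≤ k ↔ v ≤ a (k + 1) := by
  constructor
  · intro h
    by_contra hv
    have hsub : range (k + 1) ⊆ (range m).filter fun j => a (j + 1) < v := by
      intro j hj
      have := mem_range.1 hj
      exact mem_filter.2 ⟨mem_range.2 (by omega),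
        (ha (j + 1) (k + 1) (by omega) (by omega)).trans_lt (not_le.1 hv)⟩
    have := card_le_card hsub
    rw [card_range] at this
    unfold segIndex at h
    omega
  · intro h
    have hsub : ((range m).filter fun j => a (j + 1) < v) ⊆ range k := by
      intro j hj
      obtain ⟨h1, h2⟩ := mem_filter.1 hj
      rw [mem_range] at h1 ⊢
      by_contra hjk
      exact absurd h2 (not_lt.2 (h.trans (ha (k + 1) (j + 1) (by omega) (by omega))))
    exact (card_le_card hsub).trans (card_range k).le

lemma lt_of_segIndex_eq {a : ℕ → ℝ} {m k : ℕ} {v : ℝ} (ha : ∀ i j, i ≤ j → j ≤ m + 1 → a i ≤ a j)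
    (hk : segIndex a m v = k + 1) : a (k + 1) < v := by
  have h1 := segIndex_le a m v
  have h2 := (segIndex_le_iff (v := v) ha (k := k) (by omega)).not.1 (by omega)
  exact not_le.1 h2

lemma le_threshold_segIndex {a : ℕ → ℝ} {m : ℕ} {v : ℝ}
    (ha : ∀ i j, i ≤ j → j ≤ m + 1 → a i ≤ a j) (hv : v ≤ a (m + 1)) :
    v ≤ a (segIndex a m v + 1) := by
  rcases (segIndex_le a m v).lt_or_eq with h | h
  · exact (segIndex_le_iff ha h).1 le_rfl
  · rwa [h]

lemma continuous_cdf {F : Measure ℝ} [IsProbabilityMeasure F] (hF : ∀ x : ℝ, F {x} = 0) :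
    Continuous (ProbabilityTheory.cdf F) := by
  rw [continuous_iff_continuousAt]
  intro x
  have h1 := hF x
  rw [← ProbabilityTheory.measure_cdf F, StieltjesFunction.measure_singleton,
    ENNReal.ofReal_eq_zero, sub_nonpos] at h1
  rw [(ProbabilityTheory.monotone_cdf F).continuousAt_iff_leftLim_eq_rightLim,
    StieltjesFunction.rightLim_eq]
  exact le_antisymm ((ProbabilityTheory.monotone_cdf F).leftLim_le le_rfl) h1

/-- Every continuous first-price auction with iid priors (a single
atomless Borel probability distribution `F` on `[0,1]`) and a finite bidding space
`B ⊆ [0,1]` with `0 ∈ B` has a pure Bayes–Nash equilibrium that is symmetric and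
monotone (a non-decreasing step function into `B`, non-overbidding). -/
theorem stmt1 (n : ℕ) (hn : 2 ≤ n) (B : Finset ℝ)
    (hB : ↑B ⊆ Set.Icc (0:ℝ) 1) (h0B : (0:ℝ) ∈ B)
    (F : Measure ℝ) [IsProbabilityMeasure F]
    (hFsupp : F (Set.Icc (0:ℝ) 1) = 1)
    (hFatomless : ∀ x : ℝ, F {x} = 0) :
    ∃ β : ℝ → ℝ,
      MonotoneOn β (Set.Icc (0:ℝ) 1) ∧
      (∀ v ∈ Set.Icc (0:ℝ) 1, β v ∈ B ∧ β v ≤ v) ∧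
      ∀ i : Fin n, ∀ v ∈ Set.Icc (0:ℝ) 1, ∀ b ∈ B,
        cInterimIID n F (fun _ => β) i (β v) v ≥ cInterimIID n F (fun _ => β) i b v := by
  classical
  have hn0 : 0 < n := by omega
  set G : ℝ → ℝ := fun x => ProbabilityTheory.cdf F x
  have hGm : Monotone G := ProbabilityTheory.monotone_cdf F
  have hG0 : ∀ x, 0 ≤ G x := ProbabilityTheory.cdf_nonneg F
  have hG1 : ∀ x, G x ≤ 1 := ProbabilityTheory.cdf_le_one F
  have hGr : ∀ x, F.real (Set.Iic x) = G x := fun x => (ProbabilityTheory.cdf_eq_real F x).symm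
  have hcompl : F (Set.Icc (0 : ℝ) 1)ᶜ = 0 := (prob_compl_eq_zero_iff measurableSet_Icc).2 hFsupp
  have hGzero : G 0 = 0 := by
    rw [← hGr, measureReal_eq_zero_iff]
    refine measure_mono_null (t := (Set.Icc (0 : ℝ) 1)ᶜ ∪ {0}) (fun x hx => ?_)
      (measure_union_null hcompl (hFatomless 0))
    rcases (Set.mem_Iic.1 hx).lt_or_eq with h | h
    · exact Or.inl fun h' => absurd h'.1 (not_le.2 h)
    · exact Or.inr h
  have hGone : G 1 = 1 := by
    rw [← hGr, measureReal_def]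
    have : F (Set.Iic 1) = 1 :=
      le_antisymm prob_le_one (hFsupp.symm.le.trans (measure_mono Set.Icc_subset_Iic_self))
    simp [this]
  obtain ⟨m, hm⟩ : ∃ m, B.card = m + 1 :=
    Nat.exists_eq_succ_of_ne_zero (card_ne_zero_of_mem h0B)
  let e := B.orderEmbOfFin hm
  let b : ℕ → ℝ := fun k => e ⟨min k m, by omega⟩
  have hbmem : ∀ k, b k ∈ B := fun k => B.orderEmbOfFin_mem hm _
  have hbm : Monotone b := fun i j hij => e.monotone (by
    rw [Fin.mk_le_mk]; exact min_le_min_right m hij)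
  have hblt : ∀ i j, j ≤ m → i < j → b i < b j := fun i j hj hij => e.strictMono (by
    rw [Fin.mk_lt_mk]; omega)
  have hbsurj : ∀ x ∈ B, ∃ k ≤ m, b k = x := by
    intro x hx
    have : x ∈ Set.range e := by rw [range_orderEmbOfFin]; exact hx
    obtain ⟨⟨k, hk⟩, rfl⟩ := this
    refine ⟨k, by omega, ?_⟩
    change e _ = e _
    congr
    omega
  have hbnn : ∀ k, 0 ≤ b k := fun k => (hB (hbmem k)).1
  have hb0 : b 0 = 0 := by
    obtain ⟨k, -, hk⟩ := hbsurj 0 h0B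
    exact le_antisymm (hk ▸ hbm (Nat.zero_le k)) (hbnn 0)
  obtain ⟨a, ha, ha1⟩ := exists_isSupported (n := n) (continuous_cdf hFatomless) hGm hG0 hG1
    hbm hb0 m
  have hamono : ∀ i j, i ≤ j → j ≤ m + 1 → a i ≤ a j := fun i j => ha.threshold_le
  let β₀ : ℝ → ℝ := fun v => b (segIndex a m v)
  let β : ℝ → ℝ := fun v => if segProb n G a (segIndex a m v) = 0 then 0 else b (segIndex a m v)
  have hβ₀le : ∀ k ≤ m, ∀ v, β₀ v ≤ b k ↔ segIndex a m v ≤ k := by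
    intro k hk v
    refine ⟨fun h => ?_, fun h => hbm h⟩
    by_contra hlt
    exact absurd h (not_le.2 (hblt _ _ (segIndex_le a m v) (not_le.1 hlt)))
  have hβ₀lt : ∀ k ≤ m, ∀ v, β₀ v < b k ↔ segIndex a m v < k := by
    intro k hk v
    refine ⟨fun h => ?_, fun h => hblt _ _ hk h⟩
    by_contra hle
    exact absurd h (not_lt.2 (hbm (not_lt.1 hle)))
  have hβm : Monotone β := by
    intro v w hvw
    have hidx := segIndex_mono a m hvw
    simp only [β]
    split_ifs with h1 h2 h2
    · exact le_rfl
    · exact hbnn _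
    · exact absurd (le_antisymm (h2 ▸ ha.segProb_le hGm hG0 hidx (segIndex_le a m w))
        (segProb_nonneg hG0 _)) h1
    · exact hbm hidx
  have hae : β =ᵐ[F] β₀ := by
    have h1 : ∀ᵐ v ∂F, v ∈ Set.Icc (0 : ℝ) 1 := hcompl
    have h2 : ∀ᵐ v ∂F, ∀ k, G (a (k + 1)) = 0 → ¬ v ≤ a (k + 1) := by
      rw [ae_all_iff]
      intro k
      by_cases hk : G (a (k + 1)) = 0
      · have : F (Set.Iic (a (k + 1))) = 0 := by
          rwa [← measureReal_eq_zero_iff, hGr]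
        rw [measure_eq_zero_iff_ae_notMem] at this
        filter_upwards [this] with v hv _
        exact hv
      · exact Filter.Eventually.of_forall fun v h => absurd h hk
    filter_upwards [h1, h2] with v hv1 hv2
    simp only [β, β₀]
    refine if_neg fun hH => ?_
    refine hv2 (segIndex a m v) ?_ (le_threshold_segIndex hamono (ha1 ▸ hv1.2))
    by_contra hne
    exact (winProb_pos hn0 (hG0 _) (lt_of_le_of_ne (hG0 _) (Ne.symm hne))).ne' hH
  have hle : ∀ k ≤ m, F.real {v | β v ≤ b k} = G (a (k + 1)) := by
    intro k hk
    have h1 : F.real {v | β v ≤ b k} = F.real {v | β₀ v ≤ b k} :=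
      measureReal_congr (hae.mono fun v hv => by
        change (β v ≤ b k) = (β₀ v ≤ b k)
        rw [hv])
    rw [h1]
    simp only [hβ₀le k hk]
    rcases hk.lt_or_eq with h | rfl
    · simp only [segIndex_le_iff hamono h]
      exact hGr _
    · simp only [segIndex_le]
      rw [ha1, hGone]
      simp
  have hlt : ∀ k ≤ m, F.real {v | β v < b k} = G (a k) := by
    intro k hk
    have h1 : F.real {v | β v < b k} = F.real {v | β₀ v < b k} :=
      measureReal_congr (hae.mono fun v hv => by
        change (β v < b k) = (β₀ v < b k)
        rw [hv])
    rw [h1]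
    simp only [hβ₀lt k hk]
    rcases k with _ | k
    · simp [ha.1, hGzero]
    · simp only [Nat.lt_succ_iff, segIndex_le_iff hamono (show k < m by omega)]
      exact hGr _
  have hutil : ∀ i : Fin n, ∀ v, ∀ k ≤ m,
      cInterimIID n F (fun _ => β) i (b k) v = (v - b k) * segProb n G a k := by
    intro i v k hk
    rw [cInterimIID_eq F hβm.measurable, hle k hk, hlt k hk, segProb]
  have hseg : ∀ v ∈ Set.Icc (0 : ℝ) 1,
      (segIndex a m v = 0 ∨ a (segIndex a m v) < a (segIndex a m v + 1)) ∧
      v ∈ Set.Icc (a (segIndex a m v)) (a (segIndex a m v + 1)) := by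
    intro v hv
    have h1 := le_threshold_segIndex hamono (v := v) (ha1 ▸ hv.2)
    rcases h : segIndex a m v with _ | k
    · rw [h] at h1
      exact ⟨Or.inl rfl, ha.1.symm ▸ hv.1, h1⟩
    · rw [h] at h1
      have h2 := lt_of_segIndex_eq hamono h
      exact ⟨Or.inr (h2.trans_le h1), h2.le, h1⟩
  refine ⟨β, hβm.monotoneOn _, fun v hv => ?_, fun i v hv x hx => ?_⟩
  · obtain ⟨h1, h2⟩ := hseg v hv
    simp only [β]
    split_ifs with hH
    · exact ⟨h0B, hv.1⟩
    · exact ⟨hbmem _, ((ha.thrUtil_eq hG0 hb0 (segIndex_le a m v) h1 hH).2).trans h2.1⟩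
  · obtain ⟨h1, h2⟩ := hseg v hv
    obtain ⟨j, hj, rfl⟩ := hbsurj x hx
    have hk := segIndex_le a m v
    have hopt := ha.bid_le_bid hGm hG0 hb0 hj hk h1 h2
    rw [hutil i v j hj]
    refine hopt.trans (le_of_eq ?_)
    by_cases hH : segProb n G a (segIndex a m v) = 0
    · have hH0 : segProb n G a 0 = 0 :=
        le_antisymm (hH ▸ ha.segProb_le hGm hG0 (Nat.zero_le _) hk) (segProb_nonneg hG0 0)
      have hβv : β v = b 0 := by simp only [β, if_pos hH, hb0]
      rw [hβv, hutil i v 0 (Nat.zero_le m), hH, hH0, mul_zero, mul_zero]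
    · have hβv : β v = b (segIndex a m v) := by simp only [β, if_neg hH]
      rw [hβv, hutil i v _ hk]
end

section
/- Let q = 151/198 and consider the discrete first-price auction with two bidders, value spaces V_1 = V_2 = {0, 1}, bidding space B = {k/12 : k = 0, 1, …, 12}, and iid priors given by f(0) = q and f(1) = 1 − q. Then for every ε with 0 ≤ ε < 1/72, this auction has no non-overbidding ε-approximate pure Bayes–Nash equilibrium. -/
open Finset

/-- Interim utility of bidder `i` bidding `b` with value `v`, when each opponent `j`'s
value is drawn from the prior `f i j` on `V j` and `j` then bids according to the mixed
strategy `β j`. -/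
noncomputable def interim (n : ℕ) (V : Fin n → Finset ℝ) (B : Finset ℝ)
    (f : Fin n → Fin n → ℝ → ℝ) (β : Fin n → ℝ → ℝ → ℝ)
    (i : Fin n) (b : ℝ) (v : ℝ) : ℝ :=
  ∑ bb ∈ Fintype.piFinset (fun j : Fin n => if j = i then ({b} : Finset ℝ) else B),
    (∏ j ∈ Finset.univ.erase i, ∑ w ∈ V j, f i j w * β j w (bb j)) * exPost n i v bb

/-- Interim utility of bidder `i` bidding a mixed bid `γ ∈ Δ(B)` with value `v`. -/
noncomputable def interimMix (n : ℕ) (V : Fin n → Finset ℝ) (B : Finset ℝ)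
    (f : Fin n → Fin n → ℝ → ℝ) (β : Fin n → ℝ → ℝ → ℝ)
    (i : Fin n) (γ : ℝ → ℝ) (v : ℝ) : ℝ :=
  ∑ b ∈ B, γ b * interim n V B f β i b v

/-- `γ` is a probability distribution on the finite bid set `B`. -/
def IsDist (B : Finset ℝ) (γ : ℝ → ℝ) : Prop :=
  (∀ b, 0 ≤ γ b) ∧ ∑ b ∈ B, γ b = 1

/-- `β` is a mixed-strategy profile: each `β i v` is a distribution on `B` for `v ∈ V i`. -/
def IsMixedProfile (n : ℕ) (V : Fin n → Finset ℝ) (B : Finset ℝ)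
    (β : Fin n → ℝ → ℝ → ℝ) : Prop :=
  ∀ i : Fin n, ∀ v ∈ V i, IsDist B (β i v)

/-- No bidder ever puts positive probability on a bid above her value. -/
def NonOverbidding (n : ℕ) (V : Fin n → Finset ℝ) (B : Finset ℝ)
    (β : Fin n → ℝ → ℝ → ℝ) : Prop :=
  ∀ i : Fin n, ∀ v ∈ V i, ∀ b ∈ B, v < b → β i v b = 0

/-- A mixed strategy is monotone: every bid in the support at a lower value is at most
every bid in the support at a higher value. -/
def MonotoneStrat (V B : Finset ℝ) (β0 : ℝ → ℝ → ℝ) : Prop :=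
  ∀ v ∈ V, ∀ v' ∈ V, v < v' → ∀ b ∈ B, ∀ b' ∈ B, 0 < β0 v b → 0 < β0 v' b' → b ≤ b'

/-- Well-formedness of the subjective priors: for `i ≠ j`, `f i j` is a pmf on `V j`. -/
def IsPrior (n : ℕ) (V : Fin n → Finset ℝ) (f : Fin n → Fin n → ℝ → ℝ) : Prop :=
  ∀ i j : Fin n, i ≠ j →
    (∀ v, 0 ≤ f i j v) ∧ (∀ v, v ∉ V j → f i j v = 0) ∧ ∑ v ∈ V j, f i j v = 1

/-- `β` is an ε-approximate mixed Bayes–Nash equilibrium. -/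
def MBNE (n : ℕ) (V : Fin n → Finset ℝ) (B : Finset ℝ)
    (f : Fin n → Fin n → ℝ → ℝ) (β : Fin n → ℝ → ℝ → ℝ) (ε : ℝ) : Prop :=
  ∀ i : Fin n, ∀ v ∈ V i, ∀ γ : ℝ → ℝ, IsDist B γ →
    interimMix n V B f β i (β i v) v ≥ interimMix n V B f β i γ v - ε

/-- `β` is an ε-well-supported mixed Bayes–Nash equilibrium. -/
def WSMBNE (n : ℕ) (V : Fin n → Finset ℝ) (B : Finset ℝ)
    (f : Fin n → Fin n → ℝ → ℝ) (β : Fin n → ℝ → ℝ → ℝ) (ε : ℝ) : Prop :=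
  ∀ i : Fin n, ∀ v ∈ V i, ∀ b ∈ B, 0 < β i v b → ∀ γ : ℝ → ℝ, IsDist B γ →
    interim n V B f β i b v ≥ interimMix n V B f β i γ v - ε

/-- The mixed-strategy profile corresponding to a pure strategy profile `βh`. -/
noncomputable def pureToMixed (n : ℕ) (βh : Fin n → ℝ → ℝ) : Fin n → ℝ → ℝ → ℝ :=
  fun i v b => if βh i v = b then 1 else 0

/-- `βh` is an ε-approximate pure Bayes–Nash equilibrium. -/
def PurePBNE (n : ℕ) (V : Fin n → Finset ℝ) (B : Finset ℝ)
    (f : Fin n → Fin n → ℝ → ℝ) (βh : Fin n → ℝ → ℝ) (ε : ℝ) : Prop :=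
  ∀ i : Fin n, ∀ v ∈ V i, ∀ b ∈ B,
    interim n V B f (pureToMixed n βh) i (βh i v) v ≥
      interim n V B f (pureToMixed n βh) i b v - ε

/-- The ex-post utility in a two-bidder auction. -/
theorem exPost_two {i j : Fin 2} (hij : i ≠ j) (v : ℝ) (bb : Fin 2 → ℝ) :
    exPost 2 i v bb =
      if bb j < bb i then v - bb i else if bb i = bb j then (v - bb i) / 2 else 0 := by
  have hall (P : Fin 2 → Prop) : (∀ k, P k) ↔ P i ∧ P j := by
    refine ⟨fun h => ⟨h i, h j⟩, fun h k => ?_⟩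
    obtain rfl | rfl : k = i ∨ k = j := by omega
    exacts [h.1, h.2]
  have huniv : (Finset.univ : Finset (Fin 2)) = {i, j} := by
    ext k
    simp only [mem_univ, mem_insert, mem_singleton, true_iff]
    omega
  simp only [exPost, hall, huniv, filter_insert, filter_singleton]
  rcases lt_trichotomy (bb j) (bb i) with h | h | h
  · simp [h, h.le, h.not_ge]
  · simp [h, card_pair hij]
  · simp [h.not_gt, h.not_ge, h.ne]

/-- Against one opponent who plays a pure strategy, the interim utility is the expectation of the
ex-post utility over the opponent's value. -/
theorem interim_pureToMixed_two {i j : Fin 2} (hij : i ≠ j) (V : Fin 2 → Finset ℝ)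
    (B : Finset ℝ) (f : Fin 2 → Fin 2 → ℝ → ℝ) (βh : Fin 2 → ℝ → ℝ)
    (hβ : ∀ w ∈ V j, βh j w ∈ B) (b v : ℝ) :
    interim 2 V B f (pureToMixed 2 βh) i b v =
      ∑ w ∈ V j, f i j w *
        (if βh j w < b then v - b else if b = βh j w then (v - b) / 2 else 0) := by
  have herase : Finset.univ.erase i = {j} := by
    ext k
    simp only [mem_erase, mem_univ, and_true, mem_singleton]
    omega
  have hreindex : interim 2 V B f (pureToMixed 2 βh) i b v =
      ∑ c ∈ B, (∑ w ∈ V j, f i j w * if βh j w = c then 1 else 0) *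
        (if c < b then v - b else if b = c then (v - b) / 2 else 0) := by
    refine Finset.sum_bij' (fun bb _ => bb j) (fun c _ => Function.update (fun _ => b) j c)
      ?_ ?_ ?_ ?_ ?_
    · intro bb hbb
      simpa [hij.symm] using Fintype.mem_piFinset.1 hbb j
    · intro c hc
      refine Fintype.mem_piFinset.2 fun k => ?_
      obtain rfl | rfl : k = i ∨ k = j := by omega
      · simp [hij]
      · simp [hij.symm, hc]
    · intro bb hbb
      have hi : bb i = b := by simpa using Fintype.mem_piFinset.1 hbb i
      funext k
      obtain rfl | rfl : k = i ∨ k = j := by omega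
      · simp [hij, hi]
      · simp
    · simp
    · intro bb hbb
      have hi : bb i = b := by simpa using Fintype.mem_piFinset.1 hbb i
      rw [herase, prod_singleton, exPost_two hij, hi]
      rfl
  rw [hreindex]
  simp only [sum_mul]
  rw [sum_comm]
  refine sum_congr rfl fun w hw => ?_
  rw [sum_eq_single (βh j w) (fun c _ hc => by simp [hc.symm]) (fun h => absurd (hβ w hw) h)]
  simp

/-- Twice the probability of winning with bid `k` against bid `l`. -/
def doubleWinShare (k l : ℕ) : ℤ := if l < k then 2 else if k = l then 1 else 0

/-- `4752` times the interim utility of a bidder of value `1` who bids `k / 12`, when the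
opponent bids `0` at value `0` and `l / 12` at value `1`. -/
def scaledUtility (k l : ℕ) : ℤ :=
  (12 - k) * (151 * doubleWinShare k 0 + 47 * doubleWinShare k l)

theorem ite_bid_eq_doubleWinShare (k l : ℕ) :
    (if (l : ℝ) / 12 < k / 12 then 1 - (k : ℝ) / 12
      else if (k : ℝ) / 12 = l / 12 then (1 - (k : ℝ) / 12) / 2 else 0) =
      (1 - (k : ℝ) / 12) / 2 * doubleWinShare k l := by
  have hlt : (l : ℝ) / 12 < k / 12 ↔ l < k := by
    rw [div_lt_div_iff_of_pos_right (by norm_num), Nat.cast_lt]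
  have heq : (k : ℝ) / 12 = l / 12 ↔ k = l := by
    rw [div_left_inj' (by norm_num), Nat.cast_inj]
  simp only [hlt, heq, doubleWinShare]
  split_ifs <;> push_cast <;> ring

theorem exists_profitable_deviation : ∀ k < 13, ∀ l < 13, ∃ m < 13,
    scaledUtility k l + 66 ≤ scaledUtility m l ∨
      scaledUtility l k + 66 ≤ scaledUtility m k := by
  decide

/-- The concrete two-bidder auction with values `{0,1}`,
bids `{k/12 : k = 0,…,12}`, and iid prior `f(0) = 151/198`, `f(1) = 47/198`
(here `q = (M-3)/(M-1) - 2/(3M)` for `M = 12` equals `151/198`) has no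
non-overbidding ε-approximate pure Bayes–Nash equilibrium for any `0 ≤ ε < 1/72`. -/
theorem stmt3 (ε : ℝ) (hε0 : 0 ≤ ε) (hε : ε < 1/72) :
    ¬ ∃ βh : Fin 2 → ℝ → ℝ,
        (∀ i : Fin 2, ∀ v ∈ ({0, 1} : Finset ℝ),
          βh i v ∈ (Finset.range 13).image (fun k : ℕ => (k : ℝ) / 12) ∧ βh i v ≤ v) ∧
        PurePBNE 2 (fun _ => ({0, 1} : Finset ℝ))
          ((Finset.range 13).image (fun k : ℕ => (k : ℝ) / 12))
          (fun _ _ v => if v = 0 then (151/198 : ℝ) else if v = 1 then (47/198 : ℝ) else 0)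
          βh ε := by
  rintro ⟨βh, hβ, heq⟩
  have hzero (i : Fin 2) : βh i 0 = 0 := by
    obtain ⟨hmem, hle⟩ := hβ i 0 (by simp)
    obtain ⟨k, -, hk⟩ := mem_image.1 hmem
    exact le_antisymm hle (hk ▸ by positivity)
  have hone (i : Fin 2) : ∃ k : ℕ, k < 13 ∧ βh i 1 = (k : ℝ) / 12 := by
    obtain ⟨k, hk, hki⟩ := mem_image.1 (hβ i 1 (by simp)).1
    exact ⟨k, mem_range.1 hk, hki.symm⟩
  have hstable {i j : Fin 2} (hij : i ≠ j) {k l m : ℕ} (hk : βh i 1 = (k : ℝ) / 12)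
      (hl : βh j 1 = (l : ℝ) / 12) (hm : m < 13) :
      scaledUtility m l < scaledUtility k l + 66 := by
    have hdev := heq i 1 (by simp) ((m : ℝ) / 12)
      (mem_image.2 ⟨m, mem_range.2 hm, rfl⟩)
    have hval (b : ℕ) := ite_bid_eq_doubleWinShare b 0
    simp only [Nat.cast_zero, zero_div] at hval
    rw [interim_pureToMixed_two hij _ _ _ _ fun w hw => (hβ j w hw).1,
      interim_pureToMixed_two hij _ _ _ _ fun w hw => (hβ j w hw).1, hk,
      sum_pair zero_ne_one, sum_pair zero_ne_one, hzero, hl] at hdev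
    simp only [ite_bid_eq_doubleWinShare, hval, if_true, one_ne_zero, if_false] at hdev
    have hreal : (scaledUtility m l : ℝ) < scaledUtility k l + 66 := by
      simp only [scaledUtility]
      push_cast
      linarith
    exact_mod_cast hreal
  obtain ⟨k, hk, hk0⟩ := hone 0
  obtain ⟨l, hl, hl1⟩ := hone 1
  obtain ⟨m, hm, h | h⟩ := exists_profitable_deviation k hk l hl
  · exact h.not_gt (hstable zero_ne_one hk0 hl1 hm)
  · exact h.not_gt (hstable one_ne_zero hl1 hk0 hm)
end
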